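/- arXiv:2210.13854 — 6 statements merged into one kernel-verified Lean document; each statement's English description precedes it below -/
import Mathlib

section
/- Let α, O, O', d, s be real numbers with α ≥ (1+√17)/4, O ≥ 0, d ≥ 0, s ≥ 0, O' ≥ α·O + s, O' ≥ α·O + d, and (2+α)·O ≥ α·O'. Then d + s ≤ O'. -/
theorem stmt_2 (α O O' d s : ℝ) (hα : α ≥ (1 + Real.sqrt 17) / 4)
    (hO : O ≥ 0) (hd : d ≥ 0) (hs : s ≥ 0)
    (h1 : O' ≥ α * O + s) (h2 : O' ≥ α * O + d)
    (h3 : (2 + α) * O ≥ α * O') : d + s ≤ O' := by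
  have hsqrt : Real.sqrt 17 ^ 2 = 17 := Real.sq_sqrt (by norm_num)
  have hsqrt_nonneg : 0 ≤ Real.sqrt 17 := Real.sqrt_nonneg 17
  have hpos : 0 < α := by linarith
  have hquad : 2 + α ≤ 2 * α ^ 2 := by
    have hsq : Real.sqrt 17 ^ 2 ≤ (4 * α - 1) ^ 2 :=
      pow_le_pow_left₀ hsqrt_nonneg (by linarith) 2
    nlinarith
  have hle : O' ≤ 2 * α * O := by
    refine le_of_mul_le_mul_left ?_ hpos
    calc α * O' ≤ (2 + α) * O := h3
      _ ≤ 2 * α ^ 2 * O := mul_le_mul_of_nonneg_right hquad hO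
      _ = α * (2 * α * O) := by ring
  linarith
end

section
/- Let α, O, O', T, S be real numbers with α ≥ (1+√5)/2, O ≥ 0, O' ≥ α·O, T ≤ (1+α)·O, and S ≤ O'. Then T + S ≤ (1+α)·O'. -/
theorem one_add_le_sq_of_goldenRatio_le {α : ℝ} (hα : (1 + Real.sqrt 5) / 2 ≤ α) :
    1 + α ≤ α ^ 2 := by
  have h5 : Real.sqrt 5 ^ 2 = 5 := Real.sq_sqrt (by norm_num)
  nlinarith [Real.sqrt_nonneg 5]

theorem stmt_3 (α O O' T S : ℝ) (hα : α ≥ (1 + Real.sqrt 5) / 2)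
    (hO : O ≥ 0) (h1 : O' ≥ α * O) (h2 : T ≤ (1 + α) * O)
    (h3 : S ≤ O') : T + S ≤ (1 + α) * O' := by
  have hα0 : 0 ≤ α := by linarith [Real.sqrt_nonneg 5]
  have hT : T ≤ α * O' := calc
    T ≤ (1 + α) * O := h2
    _ ≤ α ^ 2 * O := mul_le_mul_of_nonneg_right (one_add_le_sq_of_goldenRatio_le hα) hO
    _ = α * (α * O) := by ring
    _ ≤ α * O' := mul_le_mul_of_nonneg_left h1 hα0
  linarith
end

section
/- Let φ = (1+√5)/2. For every real number α with 0 ≤ α < 1, one has max(1 + 3/(1+α), 2 + α + (1−α)/(2+3α)) ≥ 1 + φ. -/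
theorem stmt_10 (φ α : ℝ) (hφ : φ = (1 + Real.sqrt 5) / 2)
    (h1 : 0 ≤ α) (h2 : α < 1) :
    max (1 + 3 / (1 + α)) (2 + α + (1 - α) / (2 + 3 * α)) ≥ 1 + φ := by
  have hs : Real.sqrt 5 ^ 2 = 5 := Real.sq_sqrt (by norm_num)
  have hs0 : 0 ≤ Real.sqrt 5 := Real.sqrt_nonneg 5
  have hφ_sq : φ ^ 2 = φ + 1 := by subst hφ; linarith
  have hφ_pos : 0 < φ := by linarith
  have hφ_le : φ ≤ 2 := by nlinarith
  rcases le_total (1 + α) φ with h | h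
  · refine le_max_of_le_left ?_
    have : φ ≤ 3 / (1 + α) := by
      rw [le_div_iff₀ (by linarith)]
      nlinarith
    linarith
  · refine le_max_of_le_right ?_
    have : 0 ≤ (1 - α) / (2 + 3 * α) := div_nonneg (by linarith) (by linarith)
    linarith
end

section
/- For every real number α ≥ 0 and every real number ε with 0 < ε ≤ 1, there exists a function f : ℝ → ℝ that is 1-Lipschitz with f(0) = 0 and f(α + ε) = −α, together with real numbers p, q satisfying α + ε ≤ p ≤ q ≤ 2 + 3α, f(p) = 0, f(q) = 1, and f(2 + 3α) = 2 + α − ε. -/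
theorem stmt_16 (α ε : ℝ) (hα : α ≥ 0) (hε1 : 0 < ε) (hε2 : ε ≤ 1) :
    ∃ f : ℝ → ℝ, LipschitzWith 1 f ∧ f 0 = 0 ∧ f (α + ε) = -α ∧
      ∃ p q : ℝ,
        α + ε ≤ p ∧ p ≤ q ∧ q ≤ 2 + 3 * α ∧
        f p = 0 ∧ f q = 1 ∧ f (2 + 3 * α) = 2 + α - ε := by
  refine ⟨fun t => max (-t) (t - (2 * α + ε)), ?_, ?_, ?_, 2 * α + ε, 2 * α + ε + 1,
    by linarith, by linarith, by linarith, ?_, ?_, ?_⟩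
  · have hneg : LipschitzWith 1 (fun t : ℝ => -t) := LipschitzWith.id.neg
    have hsub : LipschitzWith 1 (fun t : ℝ => t - (2 * α + ε)) :=
      LipschitzWith.of_dist_le_mul fun x y => by simp
    simpa using hneg.max hsub
  · exact (max_eq_left (by linarith)).trans neg_zero
  all_goals exact (max_eq_right (by linarith)).trans (by ring)
end

section
/- For every real number α ≥ 0, define L(α) = max(1 + 3/(1+α), 2 + α + (1−α)/(2+3α)) if α < 1, and L(α) = max(1 + α, 2 + 2/(3α)) if α ≥ 1. Then L(α) ≥ 3/2 + √(11/12) for all α ≥ 0. -/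
open Classical in
theorem stmt_17 (α : ℝ) (hα : α ≥ 0) :
    (if α < 1 then max (1 + 3 / (1 + α)) (2 + α + (1 - α) / (2 + 3 * α))
      else max (1 + α) (2 + 2 / (3 * α))) ≥ 3 / 2 + Real.sqrt (11 / 12) := by
  have hs : Real.sqrt (11 / 12) ^ 2 = 11 / 12 := Real.sq_sqrt (by norm_num)
  have hs_nonneg := Real.sqrt_nonneg (11 / 12)
  set s := Real.sqrt (11 / 12)
  have hs_le : s ≤ 1 := by nlinarith
  have hs_ge : 1 / 2 ≤ s := by nlinarith
  split_ifs with h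
  · have h3 : 3 / 2 ≤ 3 / (1 + α) := by
      rw [div_le_div_iff₀ (by norm_num) (by linarith)]
      linarith
    exact le_max_of_le_left (by linarith)
  · -- The two branches cross at `α = 1 / 2 + s`.
    rcases le_total (1 / 2 + s) α with hc | hc
    · exact le_max_of_le_left (by linarith)
    · have h2 : s - 1 / 2 ≤ 2 / (3 * α) := by
        rw [le_div_iff₀ (by linarith)]
        nlinarith [mul_nonneg (sub_nonneg.2 hs_ge) (sub_nonneg.2 hc)]
      exact le_max_of_le_right (by linarith)
end

section
/- Let φ = (1+√5)/2. For every real number α ≥ 0, define L(α) = max(1 + 3/(1+α), 2 + α + (1−α)/(2+3α)) if α < 1, and L(α) = max(1 + α, 2 + 2/(3α)) if α ≥ 1. Then for every α ≥ 0 with α ∉ (2φ/3, φ), one has L(α) ≥ 1 + φ. -/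
open Classical in
theorem stmt_18 (φ α : ℝ) (hφ : φ = (1 + Real.sqrt 5) / 2) (hα : α ≥ 0)
    (hout : α ∉ Set.Ioo (2 * φ / 3) φ) :
    (if α < 1 then max (1 + 3 / (1 + α)) (2 + α + (1 - α) / (2 + 3 * α))
      else max (1 + α) (2 + 2 / (3 * α))) ≥ 1 + φ := by
  have h5 : Real.sqrt 5 ^ 2 = 5 := Real.sq_sqrt (by norm_num)
  have hsq : φ ^ 2 = φ + 1 := by rw [hφ]; linarith
  have hφ_lower : 3 / 2 < φ := by
    have := Real.lt_sqrt_of_sq_lt (show (2 : ℝ) ^ 2 < 5 by norm_num)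
    linarith
  split_ifs with h1
  · rcases le_or_gt (1 + α) (3 * (φ - 1)) with h | h
    · refine le_max_of_le_left ?_
      have : φ ≤ 3 / (1 + α) := by
        rw [le_div_iff₀ (by linarith)]
        nlinarith
      linarith
    · refine le_max_of_le_right ?_
      have : 0 ≤ (1 - α) / (2 + 3 * α) := div_nonneg (by linarith) (by linarith)
      linarith
  · rcases le_or_gt φ α with h | h
    · exact le_max_of_le_left (by linarith)
    · refine le_max_of_le_right ?_
      have hle : α ≤ 2 * φ / 3 := not_lt.mp fun h' => hout ⟨h', h⟩
      have : φ - 1 ≤ 2 / (3 * α) := by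
        rw [le_div_iff₀ (by linarith)]
        nlinarith
      linarith
end
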